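/- arXiv:2506.02446 — 2 statements merged into one kernel-verified Lean document; each statement's English description precedes it below -/
import Mathlib

section
/- Let v be a prime power with v ≠ 2, let u be a positive integer, and suppose that q := (v^u - 1)/(v - 1) is a prime with q > 23. Then there is no element of order (q-1)/2 in the group ΓL_u(v) of semilinear permutations of the F_v-vector space V = F_v^u; that is, there is no additive bijection g : V → V for which there exists a field automorphism σ of F_v with g(c·x) = σ(c)·g(x) for all c ∈ F_v and x ∈ V, such that g has order (q-1)/2 as a permutation of V. -/
def auxS (b n : ℕ) : ℕ := ∑ i ∈ Finset.range n, b ^ i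

lemma auxS_succ (b n : ℕ) : auxS b (n + 1) = auxS b n + b ^ n := Finset.sum_range_succ _ _

lemma auxS_succ' (b n : ℕ) : auxS b (n + 1) = 1 + b * auxS b n := by
  unfold auxS
  rw [Finset.sum_range_succ', Finset.mul_sum, pow_zero, add_comm]
  congr 1
  exact Finset.sum_congr rfl (fun i _ => by ring)

lemma auxS_mul (b n : ℕ) (hb : 1 ≤ b) : auxS b n * (b - 1) + 1 = b ^ n := by
  obtain ⟨c, rfl⟩ := Nat.exists_eq_add_of_le' hb
  rw [Nat.add_sub_cancel]
  exact geom_sum_mul_add c n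

lemma auxS_mono (b : ℕ) (hb : 1 ≤ b) : StrictMono (auxS b) := by
  apply strictMono_nat_of_lt_succ
  intro n
  rw [auxS_succ]
  have : 0 < b ^ n := pow_pos hb n
  omega

lemma auxS_one (b : ℕ) : auxS b 1 = 1 := by simp [auxS]

lemma auxS_comp (b x y : ℕ) (hb : 2 ≤ b) : auxS b (x * y) = auxS b x * auxS (b ^ x) y := by
  have h1 := auxS_mul b x (by omega)
  have h2 := auxS_mul b (x * y) (by omega)
  have h3 := auxS_mul (b ^ x) y (Nat.one_le_pow _ _ (by omega))
  rw [← pow_mul, ← h2, ← h1, Nat.add_sub_cancel, h1] at h3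
  have hc : 0 < b - 1 := by omega
  apply Nat.eq_of_mul_eq_mul_right hc
  rw [← Nat.succ_injective h3]; ring

lemma aux_uprime (v u q : ℕ) (hv : 2 ≤ v) (hq : q = auxS v u) (hqp : q.Prime) : u.Prime := by
  have h0 : u ≠ 0 := by rintro rfl; simp [auxS] at hq; subst hq; exact absurd hqp (by norm_num)
  have h1 : u ≠ 1 := by rintro rfl; rw [auxS_one] at hq; subst hq; exact absurd hqp (by norm_num)
  rw [Nat.prime_def]
  refine ⟨by omega, fun x hx => ?_⟩
  obtain ⟨y, rfl⟩ := hx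
  rw [auxS_comp _ _ _ hv] at hq
  rcases hqp.eq_one_or_self_of_dvd _ ⟨_, hq⟩ with h | h
  · left
    exact (auxS_mono v (by omega)).injective (h.trans (auxS_one v).symm)
  · right
    rw [← auxS_comp _ _ _ hv] at hq
    exact (auxS_mono v (by omega)).injective (h.trans hq)

lemma aux_rdvd (p f u q r : ℕ) (hp : 2 ≤ p) (hf : f ≠ 0) (hq : q = auxS (p ^ f) u) (hqp : q.Prime)
    (hu : u.Prime) (hr : r.Prime) (hrf : r ∣ f) : r = u := by
  by_contra hne
  obtain ⟨k, rfl⟩ := hrf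
  have hk : k ≠ 0 := by rintro rfl; simp at hf
  have hQ : 2 ≤ p ^ k := hp.trans (Nat.le_self_pow hk p)
  rw [mul_comm, pow_mul] at hq
  set Q := p ^ k
  have hcop : Nat.Coprime (auxS Q u) (auxS Q r) := by
    have h := Nat.pow_sub_one_gcd_pow_sub_one Q u r
    have h1 := auxS_mul Q u (by omega)
    have h2 := auxS_mul Q r (by omega)
    rw [(Nat.coprime_primes hu hr).2 (Ne.symm hne), pow_one, ← h1, ← h2, Nat.add_sub_cancel, Nat.add_sub_cancel, Nat.gcd_mul_right] at h
    exact Nat.eq_of_mul_eq_mul_right (by omega : 0 < Q - 1) (by rw [h, one_mul])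
  have hd : auxS Q u ∣ auxS Q r * q := by
    rw [hq, ← auxS_comp _ _ _ hQ, mul_comm r, auxS_comp _ _ _ hQ]
    exact dvd_mul_right _ _
  have hd2 := hcop.dvd_of_dvd_mul_left hd
  rcases hqp.eq_one_or_self_of_dvd _ hd2 with h | h
  · have := (auxS_mono Q (by omega)).injective (h.trans (auxS_one Q).symm)
    exact hu.one_lt.ne' this
  · have hlt : auxS Q u < auxS (Q ^ r) u := by
      unfold auxS
      apply Finset.sum_lt_sum
      · intro i _
        exact Nat.pow_le_pow_left (Nat.le_self_pow hr.ne_zero Q) i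
      · refine ⟨1, Finset.mem_range.2 hu.one_lt, ?_⟩
        rw [pow_one, pow_one]
        calc Q = Q ^ 1 := (pow_one Q).symm
          _ < Q ^ r := Nat.pow_lt_pow_right (by omega) hr.one_lt
    omega

lemma aux_B (v u s L : ℕ) (hv : 3 ≤ v) (hu : 3 ≤ u) (hs : auxS v (u - 1) = 2 * s)
    (hq : 23 < auxS v u) (hL : 0 < L) (hsL : s ∣ L)
    (hor : (∃ e, 1 ≤ e ∧ e ≤ u - 2 ∧ L = v ^ e - 1) ∨ L * (v - 1) < v ^ (u - 2)) : False := by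
  obtain ⟨n, rfl⟩ := Nat.exists_eq_add_of_le' hu
  simp only [show n + 3 - 1 = n + 2 by omega, show n + 3 - 2 = n + 1 by omega] at *
  have hsl := Nat.le_of_dvd hL hsL
  have h2s : v ^ (n + 1) < 2 * s := by
    rw [← hs, auxS_succ, auxS_succ]
    have : 0 < v ^ n := by positivity
    omega
  rcases hor with ⟨e, he1, he, rfl⟩ | h
  · have hve : v ^ e ≤ v ^ (n + 1) := Nat.pow_le_pow_right (by omega) he
    obtain ⟨c, hc⟩ := hsL
    have hc1 : c = 1 := by
      rcases c with _ | _ | c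
      · simp at hc; omega
      · rfl
      · have : s * 2 ≤ s * (c + 1 + 1) := Nat.mul_le_mul_left _ (by omega)
        omega
    subst hc1
    have hen : e = n + 1 := by
      by_contra hne
      have : v ^ e ≤ v ^ n := Nat.pow_le_pow_right (by omega) (by omega)
      rw [pow_succ] at h2s
      have : v ^ n * 3 ≤ v ^ n * v := Nat.mul_le_mul_left _ hv
      omega
    subst hen
    have h1 := auxS_mul v (n + 2) (by omega)
    rw [hs] at h1
    have hA : 1 ≤ v ^ n := Nat.one_le_pow _ _ (by omega)
    have hs' : s + 1 = v ^ (n + 1) := by omega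
    obtain ⟨w, rfl⟩ := Nat.exists_eq_add_of_le' hv
    rw [show w + 3 - 1 = w + 2 by omega, pow_succ, ← hs'] at h1
    have hs2 : w + 3 ≤ s + 1 := by rw [hs', pow_succ]; nlinarith
    -- 2 s (w+2) + 1 = (s+1)(w+3)
    have hw : w = 0 := by
      rcases Nat.eq_zero_or_pos w with h | h
      · exact h
      · nlinarith
    subst hw
    have : s = 2 := by omega
    subst this
    have hn : n = 0 := by
      by_contra hn
      have : 3 ^ 2 ≤ 3 ^ (n + 1) := Nat.pow_le_pow_right (by omega) (by omega)
      norm_num at hs' this; omega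
    subst hn
    norm_num [auxS, Finset.sum_range_succ] at hq
  · have : L * 2 ≤ L * (v - 1) := Nat.mul_le_mul_left _ (by omega)
    omega

section
open Polynomial

lemma aux_irred {F : Type*} [Field F] [Fintype F] (a : F[X]) (ha : Irreducible a)
    (hX : ¬ a ∣ X) : a ∣ X ^ (Fintype.card F ^ a.natDegree - 1) - 1 := by
  have : Fact (Irreducible a) := ⟨ha⟩
  have ha0 : a ≠ 0 := ha.ne_zero
  let pb := AdjoinRoot.powerBasis ha0
  have : Module.Finite F (AdjoinRoot a) := pb.finite
  have : Finite (AdjoinRoot a) := Module.finite_of_finite F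
  have : Fintype (AdjoinRoot a) := Fintype.ofFinite _
  have hc : Fintype.card (AdjoinRoot a) = Fintype.card F ^ a.natDegree := by
    rw [Module.card_eq_pow_finrank (K := F), pb.finrank]
    rfl
  rw [← AdjoinRoot.mk_eq_zero, map_sub, map_pow, map_one, ← hc, sub_eq_zero]
  apply FiniteField.pow_card_sub_one_eq_one
  rw [Ne, AdjoinRoot.mk_eq_zero]
  exact hX

lemma aux_lcm (x y w A B : ℕ) (hw : w ∣ x) (hw' : w ∣ y) (hx : x < A) (hy : y < B)
    (hx0 : 0 < x) : Nat.lcm x y * w < A * B := by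
  have h1 : w ∣ Nat.gcd x y := Nat.dvd_gcd hw hw'
  have h2 : w ≤ Nat.gcd x y := Nat.le_of_dvd (Nat.gcd_pos_of_pos_left _ hx0) h1
  calc Nat.lcm x y * w ≤ Nat.lcm x y * Nat.gcd x y := Nat.mul_le_mul_left _ h2
    _ = x * y := by rw [mul_comm, Nat.gcd_mul_lcm]
    _ < A * B := Nat.mul_lt_mul'' hx hy

lemma aux_Xdvd {F : Type*} [Field F] (m n : ℕ) (h : m ∣ n) :
    (X ^ m - 1 : F[X]) ∣ X ^ n - 1 := by
  obtain ⟨k, rfl⟩ := h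
  rw [pow_mul]
  simpa using sub_dvd_pow_sub_pow (X ^ m : F[X]) 1 k

lemma aux_Q {F : Type*} [Field F] [Fintype F] (b : F[X]) (hb0 : b ≠ 0) (hb : ¬ X ∣ b) 
    (hu : ¬ IsUnit b) : ∃ L n : ℕ, 0 < L ∧ b ∣ (X ^ L - 1) ^ n ∧ (Fintype.card F - 1) ∣ L ∧
      L < Fintype.card F ^ b.natDegree ∧
      ((∃ e, 1 ≤ e ∧ e ≤ b.natDegree ∧ L = Fintype.card F ^ e - 1) ∨
        L * (Fintype.card F - 1) < Fintype.card F ^ b.natDegree) := by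
  have hv : 1 < Fintype.card F := Fintype.one_lt_card
  induction b using UniqueFactorizationMonoid.induction_on_prime with
  | h₁ => exact absurd rfl hb0
  | h₂ x hx => exact absurd hx hu
  | h₃ c a hc0 ha ih =>
    have hai := ha.irreducible
    have haX : ¬ a ∣ X := by
      intro h
      apply hb
      have := (hai.associated_of_dvd irreducible_X h).symm.dvd
      exact this.mul_right _
    have h1 := aux_irred a hai haX
    have hd : 1 ≤ a.natDegree := hai.natDegree_pos
    have hp1 : 1 < Fintype.card F ^ a.natDegree := Nat.one_lt_pow (by omega) hv
    have hdv : Fintype.card F - 1 ∣ Fintype.card F ^ a.natDegree - 1 := by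
      simpa using Nat.sub_dvd_pow_sub_pow (Fintype.card F) 1 a.natDegree
    have hdeg : (a * c).natDegree = a.natDegree + c.natDegree := natDegree_mul ha.ne_zero hc0
    by_cases hcu : IsUnit c
    · refine ⟨Fintype.card F ^ a.natDegree - 1, 1, by omega, ?_, hdv, ?_, Or.inl ⟨a.natDegree, hd, by omega, rfl⟩⟩
      · rw [pow_one]
        exact (IsUnit.mul_right_dvd hcu).2 h1
      · rw [hdeg, natDegree_eq_zero_of_isUnit hcu, add_zero]; omega
    · obtain ⟨L, n, hL, hdvd, hvL, hlt, -⟩ := ih hc0 (fun h => hb (h.mul_left _)) hcu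
      have key := aux_lcm (Fintype.card F ^ a.natDegree - 1) L (Fintype.card F - 1) (Fintype.card F ^ a.natDegree) _ hdv hvL (by omega) hlt (by omega)
      rw [← pow_add, ← hdeg] at key
      refine ⟨Nat.lcm (Fintype.card F ^ a.natDegree - 1) L, n + 1, Nat.lcm_pos (by omega) hL, ?_, hvL.trans (Nat.dvd_lcm_right _ _), ?_, Or.inr key⟩
      · rw [pow_succ']
        exact mul_dvd_mul (h1.trans (aux_Xdvd _ _ (Nat.dvd_lcm_left _ _)))
          (hdvd.trans (pow_dvd_pow_of_dvd (aux_Xdvd _ _ (Nat.dvd_lcm_right _ _)) _))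
      · exact lt_of_le_of_lt (Nat.le_mul_of_pos_right _ (by omega)) key

lemma aux_G {F : Type*} [Field F] [Fintype F] (p : ℕ) [Fact p.Prime] [CharP F p] (u : ℕ)
    (hu : 3 ≤ u) (H : Module.End F (Fin u → F)) (hpos : 0 < orderOf H) (hp : p ∣ orderOf H) :
    ∃ L a : ℕ, 0 < L ∧ orderOf H ∣ p ^ a * L ∧
      ((∃ e, 1 ≤ e ∧ e ≤ u - 2 ∧ L = Fintype.card F ^ e - 1) ∨
        L * (Fintype.card F - 1) < Fintype.card F ^ (u - 2)) := by
  have hv : 1 < Fintype.card F := Fintype.one_lt_card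
  have hpp : p.Prime := Fact.out
  have hint : IsIntegral F H := Algebra.IsIntegral.isIntegral H
  have hμ0 : minpoly F H ≠ 0 := minpoly.ne_zero hint
  have hdvd : ∀ n, minpoly F H ∣ X ^ n - 1 ↔ H ^ n = 1 := by
    intro n
    rw [minpoly.dvd_iff]
    simp [sub_eq_zero]
  have hdeg : (minpoly F H).natDegree ≤ u := by
    have := natDegree_le_of_dvd (LinearMap.minpoly_dvd_charpoly H) H.charpoly_monic.ne_zero
    rw [LinearMap.charpoly_natDegree] at this
    simpa using this
  have hX : ¬ X ∣ minpoly F H := by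
    intro h
    have := h.trans ((hdvd _).2 (pow_orderOf_eq_one H))
    rw [X_dvd_iff] at this
    simp [coeff_X_pow, hpos.ne] at this
  have hns : ¬ Squarefree (minpoly F H) := by
    intro hs
    obtain ⟨m, hm⟩ := hp
    have h1 := (hdvd _).2 (pow_orderOf_eq_one H)
    have h2 : (X ^ (orderOf H) - 1 : F[X]) = (X ^ m - 1) ^ p := by
      rw [sub_pow_char, hm, one_pow, ← pow_mul, mul_comm]
    rw [h2, hs.dvd_pow_iff_dvd hpp.ne_zero, hdvd] at h1
    have hm0 : 0 < m := Nat.pos_of_ne_zero (by rintro rfl; rw [mul_zero] at hm; omega)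
    have h3 := Nat.le_of_dvd hm0 (orderOf_dvd_of_pow_eq_one h1)
    have := hpp.two_le
    nlinarith
  have : ∃ a : F[X], Irreducible a ∧ a * a ∣ minpoly F H := by
    unfold Squarefree at hns
    push Not at hns
    obtain ⟨x, hx, hxu⟩ := hns
    have hx0 : x ≠ 0 := by
      rintro rfl
      simp at hx
      exact hμ0 hx
    obtain ⟨a, ha, hax⟩ := WfDvdMonoid.exists_irreducible_factor hxu hx0
    exact ⟨a, ha, (mul_dvd_mul hax hax).trans hx⟩
  obtain ⟨a, ha, b, hab⟩ := this
  have hb0 : b ≠ 0 := by rintro rfl; simp [hμ0] at hab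
  have haX : ¬ a ∣ X := by
    intro h
    apply hX
    have := (ha.associated_of_dvd irreducible_X h).symm.dvd
    rw [hab, mul_assoc]
    exact this.mul_right _
  have h1 := aux_irred a ha haX
  have hd : 1 ≤ a.natDegree := ha.natDegree_pos
  have hp1 : 1 < Fintype.card F ^ a.natDegree := Nat.one_lt_pow (by omega) hv
  have hdv : Fintype.card F - 1 ∣ Fintype.card F ^ a.natDegree - 1 := by
    simpa using Nat.sub_dvd_pow_sub_pow (Fintype.card F) 1 a.natDegree
  have hdeg2 : (minpoly F H).natDegree = a.natDegree + a.natDegree + b.natDegree := by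
    rw [hab, natDegree_mul (mul_ne_zero ha.ne_zero ha.ne_zero) hb0, natDegree_mul ha.ne_zero ha.ne_zero]
  -- reduction
  have fin : ∀ L n : ℕ, minpoly F H ∣ (X ^ L - 1) ^ n → orderOf H ∣ p ^ n * L := by
    intro L n h
    apply orderOf_dvd_of_pow_eq_one
    rw [← hdvd, mul_comm, pow_mul]
    have : ((X ^ L) ^ p ^ n - 1 : F[X]) = (X ^ L - 1) ^ (p ^ n) := by
      rw [sub_pow_char_pow, one_pow]
    rw [this]
    exact h.trans (pow_dvd_pow _ (Nat.lt_pow_self hpp.one_lt).le)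
  by_cases hbu : IsUnit b
  · refine ⟨Fintype.card F ^ a.natDegree - 1, 2, by omega, fin _ _ ?_, Or.inl ⟨_, hd, by omega, rfl⟩⟩
    rw [hab, IsUnit.mul_right_dvd hbu, pow_two]
    exact mul_dvd_mul h1 h1
  · obtain ⟨L, n, hL, hbd, hvL, hlt, hor⟩ := aux_Q b hb0 (fun h => hX (hab ▸ h.mul_left _)) hbu
    by_cases hd1 : a.natDegree = 1
    · refine ⟨L, 2 + n, hL, fin _ _ ?_, ?_⟩
      · rw [hd1, pow_one] at h1
        have h1' := h1.trans (aux_Xdvd _ _ hvL)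
        rw [hab, pow_add, pow_two]
        exact mul_dvd_mul (mul_dvd_mul h1' h1') hbd
      · rcases hor with ⟨e, he, heb, hLe⟩ | h
        · exact Or.inl ⟨e, he, by omega, hLe⟩
        · exact Or.inr (h.trans_le (Nat.pow_le_pow_right (by omega) (by omega)))
    · have key := aux_lcm (Fintype.card F ^ a.natDegree - 1) L (Fintype.card F - 1) (Fintype.card F ^ a.natDegree) _ hdv hvL (by omega) hlt (by omega)
      rw [← pow_add] at key
      refine ⟨Nat.lcm (Fintype.card F ^ a.natDegree - 1) L, 2 + n, Nat.lcm_pos (by omega) hL, fin _ _ ?_, Or.inr ?_⟩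
      · have h1' := h1.trans (aux_Xdvd _ _ (Nat.dvd_lcm_left _ L))
        rw [hab, pow_add, pow_two]
        exact mul_dvd_mul (mul_dvd_mul h1' h1')
          (hbd.trans (pow_dvd_pow_of_dvd (aux_Xdvd _ _ (Nat.dvd_lcm_right _ _)) _))
      · exact key.trans_le (Nat.pow_le_pow_right (by omega) (by omega))

lemma aux_ppart {F : Type*} [Field F] (p : ℕ) [Fact p.Prime] [CharP F p] (u j : ℕ) (hj : u ≤ p ^ j)
    (H : Module.End F (Fin u → F)) (hpos : 0 < orderOf H) : ¬ p ^ (j + 1) ∣ orderOf H := by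
  rintro ⟨t, ht⟩
  have hpp : p.Prime := Fact.out
  have ht0 : 0 < t := Nat.pos_of_ne_zero (by rintro rfl; rw [mul_zero] at ht; omega)
  have hp0 : 0 < p ^ j := pow_pos hpp.pos j
  rcases Nat.eq_zero_or_pos u with hu | hu
  · subst hu
    have : H = 1 := Subsingleton.elim _ _
    rw [this, orderOf_one] at ht
    have := Nat.eq_one_of_mul_eq_one_right ht.symm
    have h2 : p ^ (j+1) = 1 := this
    simp [hpp.ne_one] at h2
  have : Nonempty (Fin u) := ⟨⟨0, hu⟩⟩
  have : CharP (Module.End F (Fin u → F)) p := charP_of_injective_algebraMap (FaithfulSMul.algebraMap_injective F _) p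
  have hcom : Commute (H ^ t) 1 := Commute.one_right _
  have h1 : (H ^ t - 1) ^ (p ^ (j+1)) = 0 := by
    rw [sub_pow_char_pow_of_commute _ _ hcom, one_pow, ← pow_mul, mul_comm, ← ht, pow_orderOf_eq_one, sub_self]
  have h2 : (H ^ t - 1) ^ u = 0 := by
    have := Module.End.ker_pow_le_ker_pow_finrank (H ^ t - 1) (p ^ (j+1))
    rw [h1] at this
    simp at this
    exact this
  have h3 : (H ^ t - 1) ^ (p ^ j) = 0 := pow_eq_zero_of_le hj h2
  rw [sub_pow_char_pow_of_commute _ _ hcom, one_pow, ← pow_mul, sub_eq_zero] at h3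
  have h4 := Nat.le_of_dvd (Nat.mul_pos ht0 hp0) (orderOf_dvd_of_pow_eq_one h3)
  rw [ht, pow_succ] at h4
  have := hpp.two_le
  have h5 : 0 < t * p ^ j := Nat.mul_pos ht0 hp0
  nlinarith

lemma aux_lin {F : Type*} [Field F] (u : ℕ) (g : Equiv.Perm (Fin u → F))
    (hadd : ∀ x y : Fin u → F, g (x + y) = g x + g y)
    (hs : ∀ (c : F) (x : Fin u → F), g (c • x) = c • g x) :
    ∃ H : Module.End F (Fin u → F), orderOf H = orderOf g := by
  let H : Module.End F (Fin u → F) := { toFun := g, map_add' := hadd, map_smul' := hs }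
  refine ⟨H, ?_⟩
  have h : ∀ n x, (H ^ n) x = (g ^ n) x := by
    intro n
    induction n with
    | zero => intro x; simp
    | succ n ih => intro x; rw [pow_succ, pow_succ, Module.End.mul_apply, ih]; rfl
  rw [orderOf_eq_orderOf_iff]
  intro n
  constructor
  · intro hn; ext1 x; rw [← h, hn]; rfl
  · intro hn; apply LinearMap.ext; intro x; rw [h, hn]; rfl

lemma aux_semi {F : Type*} [Field F] [Fintype F] (p f : ℕ) [Fact p.Prime] [CharP F p]
    (hf : Fintype.card F = p ^ f) (u : ℕ) (g : Equiv.Perm (Fin u → F))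
    (hadd : ∀ x y : Fin u → F, g (x + y) = g x + g y)
    (hsemi : ∃ σ : F ≃+* F, ∀ (c : F) (x : Fin u → F), g (c • x) = σ c • g x) :
    ∃ H : Module.End F (Fin u → F), orderOf H = orderOf (g ^ f) := by
  obtain ⟨σ, hσ⟩ := hsemi
  have hpp : p.Prime := Fact.out
  let : Algebra (ZMod p) F := ZMod.algebra F p
  have hfr : Module.finrank (ZMod p) F = f := by
    have := Module.card_eq_pow_finrank (K := ZMod p) (V := F)
    rw [hf, ZMod.card] at this
    exact (Nat.pow_right_injective hpp.two_le this).symm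
  let τ : F ≃ₐ[ZMod p] F := AlgEquiv.ofRingEquiv (f := σ) (by
    intro x
    exact DFunLike.congr_fun (RingHom.ext_zmod ((σ : F →+* F).comp (algebraMap (ZMod p) F)) (algebraMap (ZMod p) F)) x)
  have hτ : τ ^ f = 1 := by
    rw [← hfr, ← IsGalois.card_aut_eq_finrank (ZMod p) F]
    exact pow_card_eq_one'
  have ha : ∀ n : ℕ, ∀ x y, (g ^ n) (x + y) = (g ^ n) x + (g ^ n) y := by
    intro n
    induction n with
    | zero => intro x y; simp
    | succ n ih => intro x y; rw [pow_succ, Equiv.Perm.mul_apply, hadd, ih]; rfl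
  have hs : ∀ n : ℕ, ∀ (c : F) x, (g ^ n) (c • x) = (τ ^ n) c • (g ^ n) x := by
    intro n
    induction n with
    | zero => intro c x; simp
    | succ n ih =>
      intro c x
      rw [pow_succ, Equiv.Perm.mul_apply, hσ, ih]; rfl
  apply aux_lin
  · exact ha f
  · intro c x
    rw [hs, hτ]; rfl

end

/-- Lemma 5.6 (middle part): if `v ≠ 2` is a prime power, `u ≥ 1`, and
`q = (v^u - 1)/(v - 1)` is a prime with `q > 23`, then there is no element of order
`(q-1)/2` in `ΓL_u(v)`, the group of additive semilinear permutations of `F_v^u`.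
Here `F` is a finite field of order `v`. -/
theorem no_semilinear_element_of_order
    {F : Type*} [Field F] [Fintype F] (hv2 : Fintype.card F ≠ 2)
    (u : ℕ) (hu : 0 < u) (q : ℕ)
    (hq : q * (Fintype.card F - 1) = Fintype.card F ^ u - 1)
    (hqprime : Nat.Prime q) (hq23 : 23 < q)
    (g : Equiv.Perm (Fin u → F))
    (hadd : ∀ x y : Fin u → F, g (x + y) = g x + g y)
    (hsemi : ∃ σ : F ≃+* F, ∀ (c : F) (x : Fin u → F), g (c • x) = σ c • g x) :
    orderOf g ≠ (q - 1) / 2 := by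
  intro hord
  obtain ⟨p, hchar⟩ := CharP.exists F
  obtain ⟨⟨f, hf0⟩, hpp, hcard⟩ := FiniteField.card F p
  rw [PNat.mk_coe] at hcard
  have hfact : Fact p.Prime := ⟨hpp⟩
  obtain ⟨H, hH⟩ := aux_semi p f hcard u g hadd hsemi
  have hpos : 0 < orderOf H := hH ▸ orderOf_pos _
  have hgpos : 0 < orderOf g := orderOf_pos _
  have hv : 1 < Fintype.card F := Fintype.one_lt_card
  have hG := aux_G (F := F) p u
  have hp2 := hpp.two_le
  have hqS : q = auxS (Fintype.card F) u := by
    have := auxS_mul (Fintype.card F) u (by omega)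
    apply Nat.eq_of_mul_eq_mul_right (by omega : 0 < Fintype.card F - 1)
    omega
  have hup : u.Prime := aux_uprime _ u q (by omega) hqS hqprime
  have hu2 := hup.two_le
  have hgH : orderOf g ∣ f * orderOf H := by
    apply orderOf_dvd_of_pow_eq_one
    rw [hH, pow_mul, pow_orderOf_eq_one]
  have hqT : q = 1 + Fintype.card F * auxS (Fintype.card F) (u - 1) := by
    rw [← auxS_succ', hqS]; congr 1; omega
  rw [hqT, Nat.add_sub_cancel_left] at hord
  have hodd : q % 2 = 1 := Nat.odd_iff.1 (hqprime.odd_of_ne_two (by omega))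
  have hr : ∀ r : ℕ, r.Prime → r ∣ f → r = u := fun r h1 h2 =>
    aux_rdvd p f u q r hp2 (by omega) (hcard ▸ hqS) hqprime hup h1 h2
  -- odd characteristic
  have hoddp : 3 ≤ p → ∃ s, auxS (Fintype.card F) (u - 1) = 2 * s ∧
      orderOf g = Fintype.card F * s := by
    intro h3
    have hvodd : Odd (Fintype.card F) := hcard ▸ (hpp.odd_of_ne_two (by omega)).pow
    have h2 : 2 ∣ Fintype.card F * auxS (Fintype.card F) (u - 1) := by omega
    obtain ⟨s, hs⟩ := (Nat.Coprime.dvd_mul_left (Nat.coprime_two_left.2 hvodd)).1 h2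
    refine ⟨s, hs, ?_⟩
    rw [hord, hs, mul_left_comm]
    simp
  by_cases hf1 : f = 1
  · subst hf1
    rw [pow_one] at hcard
    have hp3 : 3 ≤ p := by omega
    obtain ⟨s, hs, hgs⟩ := hoddp hp3
    rw [pow_one] at hH
    have hu3 : 3 ≤ u := by
      by_contra h
      have : u = 2 := by omega
      subst this
      rw [show 2 - 1 = 1 from rfl, auxS_one] at hs
      omega
    obtain ⟨L, a, hL, hdv, hor⟩ := hG hu3 H hpos (by rw [hH, hgs, hcard]; exact dvd_mul_right _ _)
    refine aux_B (Fintype.card F) u s L (by omega) hu3 hs (by omega) hL ?_ hor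
    have hcop : Nat.Coprime s (p ^ a) := by
      apply Nat.Coprime.pow_right
      rw [Nat.coprime_comm, hpp.coprime_iff_not_dvd]
      intro hps
      have h1 : p ∣ auxS (Fintype.card F) (u - 1) := hs ▸ hps.mul_left 2
      rw [show u - 1 = (u - 2) + 1 by omega, auxS_succ', hcard] at h1
      have := (Nat.dvd_add_left (dvd_mul_right p _)).1 h1
      exact hpp.one_lt.ne' (Nat.dvd_one.1 this)
    rw [hH, hgs] at hdv
    exact hcop.dvd_of_dvd_mul_left ((dvd_mul_left s _).trans hdv)
  · have huf : u ∣ f := by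
      have := hr _ (Nat.minFac_prime hf1) (Nat.minFac_dvd f)
      rw [← this]; exact Nat.minFac_dvd f
    have hule : u ≤ f := Nat.le_of_dvd hf0 huf
    have htwo : p = 2 → orderOf g = 2 ^ (f - 1) * auxS (Fintype.card F) (u - 1) := by
      rintro rfl
      rw [hord]
      nth_rewrite 1 [hcard]
      rw [show 2 ^ f = 2 * 2 ^ (f - 1) by rw [← pow_succ']; congr 1; omega, mul_assoc]
      simp
    by_cases hpu : p = u
    · obtain ⟨k, hk⟩ : ∃ k, f = p ^ k :=
        ⟨_, Nat.eq_prime_pow_of_unique_prime_dvd (by omega) (fun h1 h2 => (hr _ h1 h2).trans hpu.symm)⟩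
      have hk0 : k ≠ 0 := by rintro rfl; simp at hk; omega
      have hno := aux_ppart p u 1 (by rw [pow_one, hpu]) H hpos
      have hD : ∀ D, k + 2 ≤ D → ¬ p ^ D ∣ orderOf g := by
        intro D hD hdv
        apply hno
        have h1 : p ^ (k + 2) ∣ p ^ k * orderOf H := by
          rw [← hk]
          exact ((pow_dvd_pow p hD).trans hdv).trans hgH
        rw [pow_add] at h1
        exact Nat.dvd_of_mul_dvd_mul_left (pow_pos hpp.pos k) h1
      by_cases hp3 : 3 ≤ p
      · obtain ⟨s, hs, hgs⟩ := hoddp hp3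
        refine hD f ?_ (by rw [hgs, hcard]; exact dvd_mul_right _ _)
        rw [hk]
        obtain ⟨l, rfl⟩ := Nat.exists_eq_succ_of_ne_zero hk0
        have h1 : l < p ^ l := Nat.lt_pow_self hpp.one_lt
        rw [Nat.succ_eq_add_one, pow_succ]
        nlinarith
      · have hp : p = 2 := by omega
        have h2u : u = 2 := by omega
        have hT := hqT
        rw [h2u, show 2 - 1 = 1 from rfl, auxS_one, hcard, hp, hk, hp] at hT
        by_cases hk3 : 3 ≤ k
        · refine hD (f - 1) ?_ (by rw [htwo hp, hp]; exact dvd_mul_right _ _)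
          rw [hk, hp]
          obtain ⟨l, rfl⟩ := Nat.exists_eq_add_of_le' hk3
          have h1 : l < 2 ^ l := Nat.lt_pow_self (by norm_num)
          rw [pow_add]
          omega
        · have : k = 1 ∨ k = 2 := by omega
          rcases this with rfl | rfl <;> norm_num at hT <;> omega
    · have hcop : Nat.Coprime p f := by
        rw [hpp.coprime_iff_not_dvd]
        exact fun h => hpu (hr p hpp h)
      have hD : ∀ D, u ≤ p ^ D → ¬ p ^ (D + 1) ∣ orderOf g := by
        intro D hD hdv
        apply aux_ppart p u D hD H hpos
        exact (hcop.pow_left _).dvd_of_dvd_mul_left (hdv.trans hgH)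
      by_cases hp3 : 3 ≤ p
      · obtain ⟨s, hs, hgs⟩ := hoddp hp3
        have h1 : f - 1 < p ^ (f - 1) := Nat.lt_pow_self hpp.one_lt
        refine hD (f - 1) (by omega) ?_
        rw [Nat.sub_add_cancel hf0, hgs, hcard]; exact dvd_mul_right _ _
      · have hp : p = 2 := by omega
        by_cases hf4 : 4 ≤ f
        · refine hD (f - 2) ?_ ?_
          · obtain ⟨l, rfl⟩ := Nat.exists_eq_add_of_le' hf4
            have h1 : l < 2 ^ l := Nat.lt_pow_self (by norm_num)
            rw [hp, show l + 4 - 2 = l + 2 by omega, pow_add]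
            omega
          · rw [show f - 2 + 1 = f - 1 by omega, htwo hp, hp]; exact dvd_mul_right _ _
        · have hu3 : u = 3 := by
            omega
          have hf3 : f = 3 := by omega
          have h8 : Fintype.card F = 8 := by rw [hcard, hp, hf3]; norm_num
          have h36 : orderOf g = 36 := by
            rw [htwo hp, h8, hf3, hu3]; norm_num [auxS, Finset.sum_range_succ]
          have h12 : orderOf H = 12 := by
            rw [hH, orderOf_pow, h36, hf3]; norm_num
          obtain ⟨L, a, hL, hdv, hor⟩ := hG (by omega) H hpos (by rw [h12, hp]; norm_num)
          have h3 : 3 ∣ 2 ^ a * L := by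
            rw [h12, hp] at hdv
            exact (by norm_num : 3 ∣ 12).trans hdv
          have h3L : 3 ∣ L := (Nat.Coprime.pow_right a (by norm_num : Nat.Coprime 3 2)).dvd_of_dvd_mul_left h3
          rw [h8, hu3] at hor
          rcases hor with ⟨e, he1, he2, rfl⟩ | h
          · have : e = 1 := by omega
            subst this
            norm_num at h3L
          · norm_num at h
            omega
end

section
/- Let q be a prime with q ≡ 3 (mod 4) and q > 23, let (a,b) be a valid pair in F_q^2 with a ≠ b, and let i ∈ {1,2,3}. Then no element of Atp_i(Q_{a,b}) is a product of (q+1)/4 disjoint transpositions; that is, there is no permutation α ∈ Atp_i(Q_{a,b}) with α∘α equal to the identity and with the number of x ∈ F_q satisfying α(x) ≠ x equal to (q+1)/2. -/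
open scoped Classical
open Finset

noncomputable section

variable {F : Type*} [Field F] [Fintype F]

/-- `x ∈ R_q`: `x` is a nonzero square in `F`. -/
def inR (x : F) : Prop := x ≠ 0 ∧ IsSquare x

/-- `x ∈ N_q`: `x` is a nonzero non-square in `F`. -/
def inN (x : F) : Prop := x ≠ 0 ∧ ¬ IsSquare x

/-- `(a, b)` is a valid pair: `ab ∈ R_q` and `(a-1)(b-1) ∈ R_q`. -/
def ValidPair (a b : F) : Prop := inR (a * b) ∧ inR ((a - 1) * (b - 1))

/-- The operation of the quadratic quasigroup `Q_{a,b}`: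
`x*y = x + a(y-x)` if `y - x ∈ R_q`, `x*y = x + b(y-x)` if `y - x ∈ N_q`, and `x*x = x`. -/
def qmul (a b x y : F) : F :=
  if inR (y - x) then x + a * (y - x) else x + b * (y - x)

/-- `(α, β, γ)` is an autotopism of the quadratic quasigroup `Q_{a,b}`. -/
def IsAutotopism (a b : F) (α β γ : Equiv.Perm F) : Prop :=
  ∀ x y : F, qmul a b (α x) (β y) = γ (qmul a b x y)

/-- `Atp_i(Q_{a,b})`: the projection of the autotopism group of `Q_{a,b}` onto its
`i`-th coordinate (for `i : Fin 3`). -/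
def AtpProj (a b : F) (i : Fin 3) : Set (Equiv.Perm F) :=
  {δ | ∃ α β γ : Equiv.Perm F, IsAutotopism a b α β γ ∧ δ = ![α, β, γ] i}

/-- A permutation of `F_q` is affine (an element of `AGL_d(p)`) if it has the form
`x ↦ ψ(x) + c` for an additive bijection `ψ` and a constant `c`. -/
def IsAffinePerm (f : Equiv.Perm F) : Prop :=
  ∃ (ψ : F ≃+ F) (c : F), ∀ x : F, f x = ψ x + c

/-- A set of permutations of `F_q` is 2-transitive. -/
def TwoTransitive (G : Set (Equiv.Perm F)) : Prop :=
  ∀ x₁ y₁ x₂ y₂ : F, x₁ ≠ y₁ → x₂ ≠ y₂ → ∃ g ∈ G, g x₁ = x₂ ∧ g y₁ = y₂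

set_option linter.all false

/-! ### Latin relations and subsquares -/

/-- A ternary relation in which any two coordinates determine the third. -/
structure LatRel (L : F → F → F → Prop) : Prop where
  ez : ∀ x y, ∃ z, L x y z
  ey : ∀ x z, ∃ y, L x y z
  ex : ∀ y z, ∃ x, L x y z
  uz : ∀ x y z z', L x y z → L x y z' → z = z'
  uy : ∀ x y y' z, L x y z → L x y' z → y = y'
  ux : ∀ x x' y z, L x y z → L x' y z → x = x'

/-- Subsquares of order `m`. -/
structure Sub3 (L : F → F → F → Prop) (m : ℕ) (A B C : Finset F) : Prop where
  cA : A.card = m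
  cB : B.card = m
  cC : C.card = m
  hz : ∀ x y z, L x y z → x ∈ A → y ∈ B → z ∈ C
  hy : ∀ x y z, L x y z → x ∈ A → z ∈ C → y ∈ B
  hx : ∀ x y z, L x y z → y ∈ B → z ∈ C → x ∈ A

lemma LatRel.rot {L : F → F → F → Prop} (h : LatRel L) : LatRel (fun y z x => L x y z) :=
  ⟨fun y z => h.ex y z, fun y x => h.ez x y, fun z x => h.ey x z,
   fun y z x x' h1 h2 => h.ux _ _ _ _ h1 h2, fun y z z' x h1 h2 => h.uz _ _ _ _ h1 h2,
   fun y y' z x h1 h2 => h.uy _ _ _ _ h1 h2⟩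

lemma Sub3.rot {L : F → F → F → Prop} {m : ℕ} {A B C : Finset F} (h : Sub3 L m A B C) :
    Sub3 (fun y z x => L x y z) m B C A :=
  ⟨h.cB, h.cC, h.cA, fun y z x hL h1 h2 => h.hx _ _ _ hL h1 h2,
   fun y z x hL h1 h2 => h.hz _ _ _ hL h2 h1, fun y z x hL h1 h2 => h.hy _ _ _ hL h2 h1⟩

lemma card_le_rel (P : F → F → Prop) (he : ∀ y, ∃ z, P y z)
    (hu : ∀ y y' z, P y z → P y' z → y = y') (B C : Finset F)
    (h : ∀ y ∈ B, ∀ z, P y z → z ∈ C) : B.card ≤ C.card := by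
  choose f hf using he
  refine Finset.card_le_card_of_injOn f (fun y hy => h y hy _ (hf y)) ?_
  intro y _ y' _ hyy
  refine hu y y' _ (hf y) ?_
  have := hf y'
  rwa [← hyy] at this

lemma inter_lemma {L : F → F → F → Prop} (hL : LatRel L) {k m : ℕ} (hk : 1 ≤ k)
    (hm : m = 2 * k + 1) (hcard : Fintype.card F = 4 * k + 3)
    {A₁ B₁ C₁ A₂ B₂ C₂ : Finset F} (S₁ : Sub3 L m A₁ B₁ C₁) (S₂ : Sub3 L m A₂ B₂ C₂)
    (hne : A₁ ≠ A₂) : (A₁ ∩ A₂).card ≤ k := by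
  by_contra hcon
  push Not at hcon
  obtain ⟨x, hx⟩ : (A₁ ∩ A₂).Nonempty := by
    rw [← Finset.card_pos]; omega
  rw [Finset.mem_inter] at hx
  have e1 : (C₁ ∩ C₂).card ≤ (B₁ ∩ B₂).card := by
    refine card_le_rel (fun z y => L x y z) (hL.ey x) (fun z z' y h h' => hL.uz _ _ _ _ h h') _ _ ?_
    intro z hz y h
    rw [Finset.mem_inter] at hz ⊢
    exact ⟨S₁.hy _ _ _ h hx.1 hz.1, S₂.hy _ _ _ h hx.2 hz.2⟩
  have e1' : (B₁ ∩ B₂).card ≤ (C₁ ∩ C₂).card := by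
    refine card_le_rel (fun y z => L x y z) (hL.ez x) (fun z z' y h h' => hL.uy _ _ _ _ h h') _ _ ?_
    intro z hz y h
    rw [Finset.mem_inter] at hz ⊢
    exact ⟨S₁.hz _ _ _ h hx.1 hz.1, S₂.hz _ _ _ h hx.2 hz.2⟩
  obtain ⟨x0, hx0, hx0'⟩ : ∃ x0 ∈ A₁, x0 ∉ A₂ := by
    by_contra h
    push Not at h
    exact hne (Finset.eq_of_subset_of_card_le h (by rw [S₁.cA, S₂.cA]))
  have e2 : (B₁ ∩ B₂).card ≤ (C₁ \ C₂).card := by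
    refine card_le_rel (fun y z => L x0 y z) (hL.ez x0)
      (fun z z' y h h' => hL.uy _ _ _ _ h h') _ _ ?_
    intro z hz y h
    rw [Finset.mem_inter] at hz
    rw [Finset.mem_sdiff]
    exact ⟨S₁.hz _ _ _ h hx0 hz.1, fun h' => hx0' (S₂.hx _ _ _ h hz.2 h')⟩
  have e3 : (B₂ \ B₁).card ≤ ((C₁ ∪ C₂)ᶜ).card := by
    refine card_le_rel (fun y z => L x0 y z) (hL.ez x0)
      (fun z z' y h h' => hL.uy _ _ _ _ h h') _ _ ?_
    intro z hz y h
    rw [Finset.mem_sdiff] at hz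
    rw [Finset.mem_compl, Finset.mem_union]
    rintro (h' | h')
    · exact hz.2 (S₁.hy _ _ _ h hx0 h')
    · exact hx0' (S₂.hx _ _ _ h hz.1 h')
  have c1 := Finset.card_sdiff_add_card_inter C₁ C₂
  have c2 := Finset.card_sdiff_add_card_inter B₂ B₁
  have c3 := Finset.card_union_add_card_inter C₁ C₂
  have c4 := Finset.card_compl (C₁ ∪ C₂)
  rw [Finset.inter_comm B₂ B₁] at c2
  have d1 := S₁.cC
  have d2 := S₂.cC
  have d3 := S₂.cB
  have c5 := Finset.card_le_univ (C₁ ∪ C₂)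
  obtain ⟨y, hy⟩ : (B₁ ∩ B₂).Nonempty := by
    rw [← Finset.card_pos]; omega
  rw [Finset.mem_inter] at hy
  have e4 : (A₁ ∩ A₂).card ≤ (C₁ ∩ C₂).card := by
    refine card_le_rel (fun x z => L x y z) (fun x => hL.ez x y)
      (fun z z' y h h' => hL.ux _ _ _ _ h h') _ _ ?_
    intro x hx z h
    rw [Finset.mem_inter] at hx ⊢
    exact ⟨S₁.hz _ _ _ h hx.1 hy.1, S₂.hz _ _ _ h hx.2 hy.2⟩
  omega

/-! ### Intersection numbers of translates -/

/-- Number of `x ∈ A` with `x - c ∈ B`. -/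
def corr (A B : Finset F) (c : F) : ℕ :=
  ∑ x, (if x ∈ A then 1 else 0) * (if x - c ∈ B then 1 else 0)

/-- image of a set under `x ↦ r x + c`. -/
def aff (r c : F) (A : Finset F) : Finset F := A.image (fun x => r * x + c)

lemma corr_eq (A B : Finset F) (c : F) : corr A B c = (A ∩ aff 1 c B).card := by
  have e : A ∩ aff 1 c B = Finset.univ.filter (fun x => x ∈ A ∧ x - c ∈ B) := by
    ext x
    simp only [aff, Finset.mem_inter, Finset.mem_image, Finset.mem_filter, Finset.mem_univ, true_and]
    constructor
    · rintro ⟨h, y, hy, rfl⟩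
      refine ⟨h, ?_⟩
      have : 1 * y + c - c = y := by ring
      rwa [this]
    · rintro ⟨h, h'⟩
      exact ⟨h, x - c, h', by ring⟩
  rw [e, Finset.card_filter]
  unfold corr
  refine Finset.sum_congr rfl fun x _ => ?_
  by_cases h : x ∈ A <;> simp [h]

lemma sum_ind (A : Finset F) : ∑ x, (if x ∈ A then 1 else 0) = A.card := by simp

lemma sum_ind_sub (A : Finset F) (x : F) :
    ∑ c, (if x - c ∈ A then 1 else 0) = A.card := by
  rw [← sum_ind A]
  exact Equiv.sum_comp (Equiv.subLeft x) (fun y => if y ∈ A then 1 else 0)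

lemma sum_corr (A B : Finset F) : ∑ c, corr A B c = A.card * B.card := by
  unfold corr
  rw [Finset.sum_comm]
  simp_rw [← Finset.mul_sum, sum_ind_sub]
  rw [← Finset.sum_mul, sum_ind]

lemma corr_zero (A : Finset F) : corr A A 0 = A.card := by
  rw [← sum_ind A]
  unfold corr
  refine Finset.sum_congr rfl fun x _ => ?_
  by_cases h : x ∈ A <;> simp [h]

lemma design1 {k m : ℕ} (hm : m = 2 * k + 1) (hcard : Fintype.card F = 4 * k + 3)
    (A : Finset F) (hA : A.card = m) (h : ∀ c ≠ 0, corr A A c ≤ k) :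
    ∀ c ≠ 0, corr A A c = k := by
  have h1 := sum_corr A A
  rw [← Finset.add_sum_erase _ _ (Finset.mem_univ (0 : F)), corr_zero, hA] at h1
  have h2 : ∑ c ∈ Finset.univ.erase (0 : F), k = m * m - m := by
    rw [Finset.sum_const, Finset.card_erase_of_mem (Finset.mem_univ _), Finset.card_univ, hcard,
      hm, smul_eq_mul]
    have : (2 * k + 1) * (2 * k + 1) = (4 * k + 2) * k + (2 * k + 1) := by ring
    rw [this]; simp
  have h3 : ∑ c ∈ Finset.univ.erase (0 : F), corr A A c = ∑ c ∈ Finset.univ.erase (0 : F), k := by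
    omega
  rw [Finset.sum_eq_sum_iff_of_le] at h3
  · intro c hc
    exact h3 c (by simp [hc])
  · intro c hc
    exact h c (by simpa using hc)

lemma sum_corr_sq (A B : Finset F) : ∑ c, corr A B c * corr A B c =
    ∑ x, ∑ y, (if x ∈ A then 1 else 0) * ((if y ∈ A then 1 else 0) * corr B B (x - y)) := by
  have e : ∀ x y : F, corr B B (x - y) =
      ∑ c, (if x - c ∈ B then 1 else 0) * (if y - c ∈ B then 1 else 0) := by
    intro x y
    unfold corr
    rw [← Equiv.sum_comp (Equiv.subLeft x)]
    refine Finset.sum_congr rfl fun c _ => ?_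
    have : x - c - (x - y) = y - c := by ring
    simp [this]
  simp_rw [e, Finset.mul_sum]
  have e2 : ∀ c, corr A B c * corr A B c = ∑ x, ∑ y, (if x ∈ A then 1 else 0) *
      ((if y ∈ A then 1 else 0) * ((if x - c ∈ B then 1 else 0) * (if y - c ∈ B then 1 else 0))) := by
    intro c
    unfold corr
    rw [Finset.sum_mul_sum]
    refine Finset.sum_congr rfl fun x _ => Finset.sum_congr rfl fun y _ => ?_
    ring
  simp_rw [e2]
  rw [Finset.sum_comm]
  refine Finset.sum_congr rfl fun x _ => ?_
  rw [Finset.sum_comm]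

lemma design2 {k m : ℕ} (hm : m = 2 * k + 1)
    (A B : Finset F) (hA : A.card = m) (hB : B.card = m)
    (h : ∀ c ≠ 0, corr B B c = k) (h' : ∀ c, corr A B c ≤ k) : False := by
  have h1 : ∑ c, corr A B c * corr A B c ≤ (m * m) * k := by
    have := sum_corr A B
    rw [hA, hB] at this
    rw [← this, Finset.sum_mul]
    exact Finset.sum_le_sum fun c _ => Nat.mul_le_mul_left _ (h' c)
  rw [sum_corr_sq] at h1
  have h2 : ∀ x y : F, corr B B (x - y) = k + (if x = y then (k + 1) else 0) := by
    intro x y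
    by_cases hxy : x = y
    · subst hxy
      rw [sub_self, corr_zero, hB]; simp; omega
    · rw [h _ (sub_ne_zero.2 hxy)]; simp [hxy]
  simp_rw [h2, mul_add, Finset.sum_add_distrib] at h1
  have h3 : ∑ x, ∑ y, (if x ∈ A then 1 else 0) * ((if y ∈ A then 1 else 0) * k) = m * m * k := by
    simp_rw [← Finset.mul_sum, ← Finset.sum_mul, sum_ind, hA]; ring
  have h4 : ∑ x, ∑ y, (if x ∈ A then 1 else 0) * ((if y ∈ A then 1 else 0) *
      (if x = y then (k + 1) else 0)) = m * (k + 1) := by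
    rw [← hA, ← sum_ind A, Finset.sum_mul]
    refine Finset.sum_congr rfl fun x _ => ?_
    rw [Finset.sum_eq_single x]
    · by_cases hx : x ∈ A <;> simp [hx]
    · intro y _ hy
      simp [hy.symm]
    · simp
  rw [h3, h4] at h1
  have : 0 < m * (k + 1) := by subst hm; positivity
  omega

/-! ### Affine images -/

lemma mem_aff {r c : F} {A : Finset F} {x : F} : x ∈ aff r c A ↔ ∃ y ∈ A, r * y + c = x := by
  simp [aff]

lemma aff_inj {r : F} (hr : r ≠ 0) (c : F) : Function.Injective (fun x : F => r * x + c) := by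
  intro x y h
  exact mul_left_cancel₀ hr (add_right_cancel h)

lemma card_aff {r : F} (hr : r ≠ 0) (c : F) (A : Finset F) : (aff r c A).card = A.card :=
  Finset.card_image_of_injective _ (aff_inj hr c)

lemma sum_aff {r : F} (hr : r ≠ 0) (c : F) (A : Finset F) :
    ∑ x ∈ aff r c A, x = r * ∑ x ∈ A, x + A.card * c := by
  unfold aff
  rw [Finset.sum_image (fun x _ y _ h => aff_inj hr c h), Finset.sum_add_distrib, Finset.mul_sum]
  simp

lemma aff_aff (r c r' c' : F) (A : Finset F) :
    aff r' c' (aff r c A) = aff (r' * r) (r' * c + c') A := by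
  unfold aff
  rw [Finset.image_image]
  congr 1
  funext x
  simp only [Function.comp]
  ring

lemma aff_id (A : Finset F) : aff 1 0 A = A := by
  unfold aff; simp

/-- The relation is invariant under the maps `x ↦ r x + c`, `r` a nonzero square. -/
def AffInv (L : F → F → F → Prop) : Prop :=
  ∀ r c, inR r → ∀ x y z, L x y z → L (r * x + c) (r * y + c) (r * z + c)

lemma AffInv.rot {L : F → F → F → Prop} (h : AffInv L) : AffInv (fun y z x => L x y z) :=
  fun r c hr y z x hL => h r c hr x y z hL

lemma sub_aff {L : F → F → F → Prop} (hL : LatRel L) (hI : AffInv L) {m : ℕ}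
    {A B C : Finset F} (S : Sub3 L m A B C) {r : F} (hr : inR r) (c : F) :
    Sub3 L m (aff r c A) (aff r c B) (aff r c C) := by
  refine ⟨by rw [card_aff hr.1, S.cA], by rw [card_aff hr.1, S.cB], by rw [card_aff hr.1, S.cC],
    ?_, ?_, ?_⟩
  · intro x y z h hx hy
    rw [mem_aff] at *
    obtain ⟨x', hx', rfl⟩ := hx
    obtain ⟨y', hy', rfl⟩ := hy
    obtain ⟨z', hz'⟩ := hL.ez x' y'
    exact ⟨z', S.hz _ _ _ hz' hx' hy', hL.uz _ _ _ _ (hI r c hr _ _ _ hz') h⟩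
  · intro x y z h hx hy
    rw [mem_aff] at *
    obtain ⟨x', hx', rfl⟩ := hx
    obtain ⟨y', hy', rfl⟩ := hy
    obtain ⟨z', hz'⟩ := hL.ey x' y'
    exact ⟨z', S.hy _ _ _ hz' hx' hy', hL.uy _ _ _ _ (hI r c hr _ _ _ hz') h⟩
  · intro x y z h hx hy
    rw [mem_aff] at *
    obtain ⟨x', hx', rfl⟩ := hx
    obtain ⟨y', hy', rfl⟩ := hy
    obtain ⟨z', hz'⟩ := hL.ex x' y'
    exact ⟨z', S.hx _ _ _ hz' hx' hy', hL.ux _ _ _ _ (hI r c hr _ _ _ hz') h⟩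

lemma two_m {k m : ℕ} (hm : m = 2 * k + 1) (hcard : Fintype.card F = 4 * k + 3) :
    2 * (m : F) = -1 := by
  have h := FiniteField.cast_card_eq_zero F
  rw [hcard] at h
  rw [hm]
  push_cast at h ⊢
  linear_combination h

lemma inR_one : inR (1 : F) := ⟨one_ne_zero, IsSquare.one⟩

lemma design_of_sub {L : F → F → F → Prop} (hL : LatRel L) (hI : AffInv L) {k m : ℕ} (hk : 1 ≤ k)
    (hm : m = 2 * k + 1) (hcard : Fintype.card F = 4 * k + 3) {A B C : Finset F}
    (S : Sub3 L m A B C) : ∀ c ≠ 0, corr A A c = k := by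
  refine design1 hm hcard A S.cA fun c hc => ?_
  rw [corr_eq]
  refine inter_lemma hL hk hm hcard S (sub_aff hL hI S inR_one c) ?_
  intro h
  have h1 := sum_aff one_ne_zero c A
  rw [← h, S.cA] at h1
  have h2 := two_m hm hcard
  apply hc
  linear_combination (2 * h1) + c * h2

lemma exists_translate {L : F → F → F → Prop} (hL : LatRel L) (hI : AffInv L) {k m : ℕ}
    (hk : 1 ≤ k) (hm : m = 2 * k + 1) (hcard : Fintype.card F = 4 * k + 3) {A B C : Finset F}
    (S : Sub3 L m A B C) {r : F} (hr : inR r) : ∃ c, aff r 0 A = aff 1 c A := by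
  by_contra hcon
  push Not at hcon
  refine design2 hm (aff r 0 A) A (by rw [card_aff hr.1, S.cA]) S.cA
    (design_of_sub hL hI hk hm hcard S) fun c => ?_
  rw [corr_eq]
  exact inter_lemma hL hk hm hcard (sub_aff hL hI S hr 0) (sub_aff hL hI S inR_one c) (hcon c)

lemma normalize_sub {L : F → F → F → Prop} (hL : LatRel L) (hI : AffInv L) {k m : ℕ}
    (hk : 1 ≤ k) (hm : m = 2 * k + 1) (hcard : Fintype.card F = 4 * k + 3) {A B C : Finset F}
    (S : Sub3 L m A B C) : ∃ A' B' C', Sub3 L m A' B' C' ∧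
      ∀ r, inR r → aff r 0 A' = A' ∧ aff r 0 B' = B' ∧ aff r 0 C' = C' := by
  set t : F := -2 * ∑ x ∈ A, x with ht
  refine ⟨aff 1 (-t) A, aff 1 (-t) B, aff 1 (-t) C, sub_aff hL hI S inR_one _, fun r hr => ?_⟩
  have key : ∀ D : Finset F, aff r (t - r * t) D = D → aff r 0 (aff 1 (-t) D) = aff 1 (-t) D := by
    intro D h
    conv_rhs => rw [← h]
    rw [aff_aff, aff_aff]
    congr 1 <;> ring
  have hA : aff r (t - r * t) A = A := by
    obtain ⟨c, hc⟩ := exists_translate hL hI hk hm hcard S hr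
    have h1 := congrArg (fun D : Finset F => ∑ x ∈ D, x) hc
    simp only [sum_aff hr.1, sum_aff one_ne_zero, S.cA] at h1
    have h2 := two_m hm hcard
    have h3 : c = r * t - t := by
      rw [ht]; linear_combination (2 * h1) + c * h2
    have h4 := congrArg (aff 1 (-c)) hc
    rw [aff_aff, aff_aff] at h4
    have e : aff (1 * 1) (1 * c + -c) A = A := by
      have : (1 : F) * c + -c = 0 := by ring
      rw [this, mul_one, aff_id]
    rw [e] at h4
    conv_rhs => rw [← h4]
    rw [h3]
    congr 1 <;> ring
  have S2 := sub_aff hL hI S hr (t - r * t)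
  rw [hA] at S2
  have hAne : A.Nonempty := by
    rw [← Finset.card_pos, S.cA]; omega
  obtain ⟨x, hx⟩ := hAne
  have hB : aff r (t - r * t) B = B := by
    obtain ⟨c, hc⟩ := exists_translate hL.rot hI.rot hk hm hcard S.rot hr
    have h4 := congrArg (aff 1 (t - r * t)) hc
    rw [aff_aff, aff_aff] at h4
    have e1 : (1 : F) * r = r := one_mul r
    have e2 : (1 : F) * 0 + (t - r * t) = t - r * t := by ring
    rw [e1, e2, mul_one] at h4
    by_cases hd : 1 * c + (t - r * t) = 0
    · rw [hd, aff_id] at h4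
      exact h4
    · exfalso
      have h5 := design_of_sub hL.rot hI.rot hk hm hcard S.rot _ hd
      rw [corr_eq, ← h4] at h5
      obtain ⟨y, hy⟩ : (B ∩ aff r (t - r * t) B).Nonempty := by
        rw [← Finset.card_pos]; omega
      rw [Finset.mem_inter] at hy
      have e3 : A.card ≤ (C ∩ aff r (t - r * t) C).card := by
        refine card_le_rel (fun x z => L x y z) (fun x => hL.ez x y)
          (fun z z' y h h' => hL.ux _ _ _ _ h h') _ _ ?_
        intro x hx z h
        rw [Finset.mem_inter]
        exact ⟨S.hz _ _ _ h hx hy.1, S2.hz _ _ _ h hx hy.2⟩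
      have e4 : (C ∩ aff r (t - r * t) C).card ≤ (B ∩ aff r (t - r * t) B).card := by
        refine card_le_rel (fun z y => L x y z) (hL.ey x)
          (fun z z' y h h' => hL.uz _ _ _ _ h h') _ _ ?_
        intro z hz y h
        rw [Finset.mem_inter] at hz ⊢
        exact ⟨S.hy _ _ _ h hx hz.1, S2.hy _ _ _ h hx hz.2⟩
      have := S.cA
      omega
  rw [hB] at S2
  have hC : aff r (t - r * t) C = C := by
    refine Finset.eq_of_subset_of_card_le ?_ (by rw [S.cC, S2.cC])
    intro z hz
    obtain ⟨y, hy⟩ := hL.ey x z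
    exact S.hz _ _ _ hy hx (S2.hy _ _ _ hy hx hz)
  exact ⟨key _ hA, key _ hB, key _ hC⟩

/-! ### The final contradiction -/

lemma chi_R {r : F} : inR r ↔ quadraticChar F r = 1 := by
  constructor
  · intro h; exact (quadraticChar_one_iff_isSquare h.1).2 h.2
  · intro h
    have h0 : r ≠ 0 := by rintro rfl; simp at h
    exact ⟨h0, (quadraticChar_one_iff_isSquare h0).1 h⟩

lemma sign_set {m : ℕ} (hm2 : 2 ≤ m) (hcard : Fintype.card F = 2 * m + 1) (A : Finset F)
    (hA : A.card = m) (h : ∀ r, inR r → aff r 0 A = A) :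
    ∃ σ : ℤ, (σ = 1 ∨ σ = -1) ∧ ∀ x ≠ 0, (x ∈ A ↔ quadraticChar F x = σ) := by
  have hmul : ∀ x ∈ A, x ≠ 0 → ∀ y, y ≠ 0 → quadraticChar F y = quadraticChar F x → y ∈ A := by
    intro x hx hx0 y hy0 hxy
    have hr : inR (y * x) := by
      rw [chi_R, map_mul, hxy, ← sq, quadraticChar_sq_one hx0]
    have hr' : inR (y * x * (x⁻¹) ^ 2) :=
      ⟨by simp [hx0, hy0], hr.2.mul (IsSquare.sq _)⟩
    rw [← h _ hr', mem_aff]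
    exact ⟨x, hx, by field_simp; ring⟩
  obtain ⟨u, hu, hu0⟩ : ∃ u ∈ A, u ≠ 0 := Finset.exists_mem_ne (by omega) 0
  refine ⟨quadraticChar F u, quadraticChar_dichotomy hu0, fun x hx0 => ⟨fun hx => ?_, fun hx => ?_⟩⟩
  · by_contra hne
    have : Finset.univ.erase (0 : F) ⊆ A := by
      intro y hy
      have hy0 : y ≠ 0 := by simpa using hy
      by_cases e : quadraticChar F y = quadraticChar F u
      · exact hmul u hu hu0 y hy0 e
      · refine hmul x hx hx0 y hy0 ?_
        rcases quadraticChar_dichotomy hu0 with h1 | h1 <;>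
        rcases quadraticChar_dichotomy hx0 with h2 | h2 <;>
        rcases quadraticChar_dichotomy hy0 with h3 | h3 <;> simp_all
    have := Finset.card_le_card this
    rw [Finset.card_erase_of_mem (Finset.mem_univ _), Finset.card_univ] at this
    omega
  · exact hmul u hu hu0 x hx0 hx

lemma exceptional {L : F → F → F → Prop} (hL : LatRel L) {m : ℕ}
    (hcard : Fintype.card F = 2 * m + 1) {A B C : Finset F}
    (S : Sub3 L m A B C) {x : F} (hx : x ∉ A) :
    ∃ y0, ∀ y, y ∉ B → y ≠ y0 → ∀ z, L x y z → z ∈ C := by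
  have h1 : C.card ≤ ((Bᶜ).filter (fun y => ∀ z, L x y z → z ∈ C)).card := by
    refine card_le_rel (fun z y => L x y z) (hL.ey x) (fun z z' y h h' => hL.uz _ _ _ _ h h') _ _ ?_
    intro z hz y h
    rw [Finset.mem_filter, Finset.mem_compl]
    refine ⟨fun hy => hx (S.hx _ _ _ h hy hz), fun z' h' => ?_⟩
    rwa [hL.uz _ _ _ _ h' h]
  have h2 := Finset.card_filter_add_card_filter_not (s := Bᶜ) (fun y => ∀ z, L x y z → z ∈ C)
  have h3 := Finset.card_compl B
  rw [S.cB] at h3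
  rw [S.cC] at h1
  have h4 : ((Bᶜ).filter (fun y => ¬ ∀ z, L x y z → z ∈ C)).card ≤ 1 := by omega
  obtain ⟨y0, hy0⟩ := Finset.card_le_one_iff_subset_singleton.1 h4
  refine ⟨y0, fun y hy hne => ?_⟩
  by_contra hcon
  have : y ∈ (Bᶜ).filter (fun y => ¬ ∀ z, L x y z → z ∈ C) := by
    rw [Finset.mem_filter, Finset.mem_compl]
    exact ⟨hy, hcon⟩
  exact hne (by simpa using hy0 this)

/-! ### The quadratic quasigroup -/

/-- The graph of the operation of `Q_{a,b}`. -/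
def QL (a b : F) : F → F → F → Prop := fun x y z => qmul a b x y = z

lemma inR_mul {x y : F} (hx : inR x) (hy : inR y) : inR (x * y) :=
  ⟨mul_ne_zero hx.1 hy.1, hx.2.mul hy.2⟩

lemma mixed {a b u u' : F} (hab : inR (a * b)) (hu : inR u) (h : a * u = b * u') : inR u' := by
  have hb : b ≠ 0 := right_ne_zero_of_mul hab.1
  have e : u' = (a * b) * u * (b⁻¹) ^ 2 := by
    field_simp
    linear_combination -h
  rw [e]
  exact inR_mul (inR_mul hab hu) ⟨by simp [hb], IsSquare.sq _⟩

lemma cancel_sel {a b u u' : F} (hab : inR (a * b))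
    (h : (if inR u then a * u else b * u) = (if inR u' then a * u' else b * u')) : u = u' := by
  have ha : a ≠ 0 := left_ne_zero_of_mul hab.1
  have hb : b ≠ 0 := right_ne_zero_of_mul hab.1
  by_cases h1 : inR u <;> by_cases h2 : inR u' <;> simp only [h1, h2, if_true, if_false] at h
  · exact mul_left_cancel₀ ha h
  · exact absurd (mixed hab h1 h) h2
  · exact absurd (mixed hab h2 h.symm) h1
  · exact mul_left_cancel₀ hb h

lemma qmul_left (a b x y : F) :
    qmul a b x y = x + (if inR (y - x) then a * (y - x) else b * (y - x)) := by
  unfold qmul; split_ifs <;> rfl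

lemma qmul_right (a b x y : F) : qmul a b x y =
    y + (if inR (y - x) then (a - 1) * (y - x) else (b - 1) * (y - x)) := by
  unfold qmul; split_ifs <;> ring

lemma QL_lat {a b : F} (hv : ValidPair a b) : LatRel (QL a b) := by
  have uy : ∀ x y y', qmul a b x y = qmul a b x y' → y = y' := by
    intro x y y' h
    rw [qmul_left, qmul_left] at h
    exact sub_left_injective (cancel_sel hv.1 (add_left_cancel h))
  have ux : ∀ x x' y, qmul a b x y = qmul a b x' y → x = x' := by
    intro x x' y h
    rw [qmul_right, qmul_right] at h
    exact sub_right_injective (cancel_sel hv.2 (add_left_cancel h))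
  refine ⟨fun x y => ⟨_, rfl⟩, fun x z => ?_, fun y z => ?_, ?_, ?_, ?_⟩
  · exact Finite.injective_iff_surjective.1 (fun y y' h => uy x y y' h) z
  · exact (Finite.injective_iff_surjective (f := fun x => qmul a b x y)).1
      (fun x x' h => ux x x' y h) z
  · intro x y z z' h h'
    exact h.symm.trans h'
  · intro x y y' z h h'
    exact uy x y y' (h.trans h'.symm)
  · intro x x' y z h h'
    exact ux x x' y (h.trans h'.symm)

lemma inR_mul_iff {r u : F} (hr : inR r) : inR (r * u) ↔ inR u := by
  rw [chi_R] at hr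
  rw [chi_R, chi_R, map_mul, hr, one_mul]

lemma QL_aff (a b : F) : AffInv (QL a b) := by
  rintro r c hr x y z rfl
  unfold QL qmul
  have e : r * y + c - (r * x + c) = r * (y - x) := by ring
  simp only [e, inR_mul_iff hr]
  split_ifs <;> ring

lemma final {a b : F} (hv : ValidPair a b) (hab : a ≠ b) {m : ℕ} (hm : 6 ≤ m)
    (hcard : Fintype.card F = 2 * m + 1) (hmod : Fintype.card F % 4 = 3) {A B C : Finset F}
    (S : Sub3 (QL a b) m A B C)
    (hI : ∀ r, inR r → aff r 0 A = A ∧ aff r 0 B = B ∧ aff r 0 C = C) : False := by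
  have hL := QL_lat hv
  have ha : a ≠ 0 := left_ne_zero_of_mul hv.1.1
  have hb : b ≠ 0 := right_ne_zero_of_mul hv.1.1
  have hneg : quadraticChar F (-1) = -1 := by
    rw [quadraticChar_neg_one_iff_not_isSquare, FiniteField.isSquare_neg_one_iff]
    simpa using hmod
  have hnegx : ∀ x : F, quadraticChar F (-x) = - quadraticChar F x := by
    intro x
    rw [← neg_one_mul, map_mul, hneg]; ring
  obtain ⟨σA, hσA, hA⟩ := sign_set (by omega) hcard A S.cA (fun r hr => (hI r hr).1)
  obtain ⟨σB, hσB, hB⟩ := sign_set (by omega) hcard B S.cB (fun r hr => (hI r hr).2.1)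
  obtain ⟨σC, hσC, hC⟩ := sign_set (by omega) hcard C S.cC (fun r hr => (hI r hr).2.2)
  obtain ⟨w, hw0, hw⟩ : ∃ w : F, w ≠ 0 ∧ quadraticChar F w = σA := by
    rcases hσA with h | h
    · exact ⟨1, one_ne_zero, by rw [h]; simp⟩
    · exact ⟨-1, by simp, by rw [h, hneg]⟩
  have hwA : w ∈ A := (hA w hw0).2 hw
  have hwA' : -w ∉ A := by
    rw [hA (-w) (neg_ne_zero.2 hw0), hnegx, hw]
    rcases hσA with h | h <;> rw [h] <;> norm_num
  obtain ⟨y0, hy0⟩ := exceptional hL hcard S hwA'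
  have hRneg : ∀ u : F, u ≠ 0 → (inR (-u) ↔ ¬ inR u) := by
    intro u hu
    rw [chi_R, chi_R, hnegx]
    rcases quadraticChar_dichotomy hu with h | h <;> rw [h] <;> norm_num
  -- the key sign identity
  have key0 : ∀ v e e' : F, v ≠ 0 → w + v ≠ 0 → -w - v ≠ y0 → w + e * v ≠ 0 → w + e' * v ≠ 0 →
      qmul a b w (w + v) = w + e * v → qmul a b (-w) (-w - v) = -(w + e' * v) →
      quadraticChar F (w + e * v) * quadraticChar F (w + e' * v) = -1 := by
    intro v e e' hv0 hy hyy hz hz' h1 h2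
    have r1 : w + v ∈ B ↔ w + e * v ∈ C :=
      ⟨fun h => S.hz _ _ _ h1 hwA h, fun h => S.hy _ _ _ h1 hwA h⟩
    have r2 : -w - v ∈ B ↔ ¬ -(w + e' * v) ∈ C := by
      constructor
      · exact fun h h' => hwA' (S.hx _ _ _ h2 h h')
      · intro h
        by_contra h'
        exact h (hy0 _ h' hyy _ h2)
    have e3 : -w - v = -(w + v) := by ring
    rw [e3, hB _ (neg_ne_zero.2 hy), hC _ (neg_ne_zero.2 hz'), hnegx, hnegx] at r2
    rw [hB _ hy, hC _ hz] at r1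
    rcases quadraticChar_dichotomy hy with q1 | q1 <;>
    rcases quadraticChar_dichotomy hz with q2 | q2 <;>
    rcases quadraticChar_dichotomy hz' with q3 | q3 <;>
    rcases hσB with q4 | q4 <;> rcases hσC with q5 | q5 <;>
    rw [q1, q4, q2, q5] at r1 <;> rw [q1, q4, q3, q5] at r2 <;> rw [q2, q3] <;>
    revert r1 r2 <;> decide
  have key : ∀ v : F, v ≠ 0 → w + v ≠ 0 → -w - v ≠ y0 → w + a * v ≠ 0 → w + b * v ≠ 0 →
      quadraticChar F (w + a * v) * quadraticChar F (w + b * v) = -1 := by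
    intro v hv0 h1 h2 h3 h4
    have e1 : w + v - w = v := by ring
    have e2 : -w - v - -w = -v := by ring
    by_cases hR : inR v
    · have hR' : ¬ inR (-v) := by rw [hRneg v hv0]; exact not_not.2 hR
      refine key0 v a b hv0 h1 h2 h3 h4 ?_ ?_
      · unfold qmul; rw [e1, if_pos hR]
      · unfold qmul; rw [e2, if_neg hR']; ring
    · have hR' : inR (-v) := by rw [hRneg v hv0]; exact hR
      rw [mul_comm]
      refine key0 v b a hv0 h1 h2 h4 h3 ?_ ?_
      · unfold qmul; rw [e1, if_neg hR]
      · unfold qmul; rw [e2, if_pos hR']; ring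
  -- count
  set E : Finset F := {0, -w, -w - y0, -w / a, -w / b} with hE
  have hEc : E.card ≤ 5 := Finset.card_le_five
  have hgood : ∀ v ∈ Eᶜ, w + b * v ≠ 0 ∧
      quadraticChar F (w + a * v) * quadraticChar F (w + b * v) = -1 := by
    intro v hv'
    simp only [hE, Finset.mem_compl, Finset.mem_insert, Finset.mem_singleton, not_or] at hv'
    obtain ⟨h1, h2, h3, h4, h5⟩ := hv'
    have h5' : w + b * v ≠ 0 := fun h => h5 (by field_simp; linear_combination h)
    have h4' : w + a * v ≠ 0 := fun h => h4 (by field_simp; linear_combination h)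
    refine ⟨h5', key v h1 (fun h => h2 (by linear_combination h))
      (fun h => h3 (by linear_combination -h)) h4' h5'⟩
  let f : F → F := fun v => (w + a * v) / (w + b * v)
  have hinj : Set.InjOn f (Eᶜ : Finset F) := by
    intro v hv1 v' hv2 h
    have g1 := (hgood v (by simpa using hv1)).1
    have g2 := (hgood v' (by simpa using hv2)).1
    simp only [f] at h
    rw [div_eq_div_iff g1 g2] at h
    have h' : (w * (a - b)) * (v - v') = 0 := by linear_combination h
    rcases mul_eq_zero.1 h' with h'' | h''
    · exact absurd h'' (mul_ne_zero hw0 (sub_ne_zero.2 hab))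
    · exact sub_eq_zero.1 h''
  have hchi : ∀ v ∈ Eᶜ, quadraticChar F (f v) = -1 := by
    intro v hv1
    obtain ⟨g1, g2⟩ := hgood v hv1
    have e : f v * (w + b * v) ^ 2 = (w + a * v) * (w + b * v) := by
      simp only [f]; field_simp
    have e' := congrArg (quadraticChar F) e
    rw [map_mul, map_mul, g2, map_pow, quadraticChar_sq_one g1, mul_one] at e'
    exact e'
  have hc1 := Finset.card_image_of_injOn hinj
  have hc2 : ((Eᶜ).image (fun v => - f v)).card = (Eᶜ).card := by
    refine Finset.card_image_of_injOn ?_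
    intro v hv1 v' hv2 h
    exact hinj hv1 hv2 (neg_injective h)
  have hdis : Disjoint ((Eᶜ).image f) ((Eᶜ).image (fun v => - f v)) := by
    rw [Finset.disjoint_left]
    intro x hx hx'
    obtain ⟨v, hv1, rfl⟩ := Finset.mem_image.1 hx
    obtain ⟨v', hv2, h⟩ := Finset.mem_image.1 hx'
    have := congrArg (quadraticChar F) h
    simp only [hnegx, hchi v hv1, hchi v' hv2] at this
    norm_num at this
  have hc3 := Finset.card_le_univ ((Eᶜ).image f ∪ (Eᶜ).image (fun v => - f v))
  rw [Finset.card_union_of_disjoint hdis, hc1, hc2, Finset.card_compl] at hc3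
  omega

/-! ### Fixed points of autotopisms -/

lemma fixed_sub {L : F → F → F → Prop} (hL : LatRel L) {m : ℕ} (hm : 1 ≤ m)
    (hcard : Fintype.card F = 2 * m + 1) (α β γ : Equiv.Perm F)
    (h : ∀ x y z, L x y z → L (α x) (β y) (γ z)) (h2 : ∀ x, α (α x) = x)
    (hA : (Finset.univ.filter fun x : F => α x = x).card = m) :
    ∃ A B C, Sub3 L m A B C := by
  have hpow : ∀ n : ℕ, ∀ x y z, L x y z → L ((α ^ n) x) ((β ^ n) y) ((γ ^ n) z) := by
    intro n
    induction n with
    | zero => intro x y z hxyz; simpa using hxyz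
    | succ n ih =>
      intro x y z hxyz
      simp only [pow_succ', Equiv.Perm.mul_apply]
      exact h _ _ _ (ih _ _ _ hxyz)
  obtain ⟨e, n, hn, he⟩ := Nat.exists_eq_two_pow_mul_odd (orderOf_pos β).ne'
  have hα2 : α ^ 2 = 1 := by
    ext x; simp [pow_two, h2]
  have hαn : α ^ n = α := by
    obtain ⟨j, rfl⟩ := hn
    rw [pow_add, pow_mul, hα2]; simp
  have hβ : (β ^ n) ^ 2 ^ e = 1 := by
    rw [← pow_mul, mul_comm, ← he, pow_orderOf_eq_one]
  haveI : Fact (Nat.Prime 2) := ⟨Nat.prime_two⟩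
  obtain ⟨y, hy⟩ := Equiv.Perm.exists_fixed_point_of_prime (p := 2) (by omega) hβ
  have hp := hpow n
  rw [hαn] at hp
  generalize β ^ n = β' at hp hy
  generalize γ ^ n = γ' at hp
  obtain ⟨x, hx⟩ : (Finset.univ.filter fun x : F => α x = x).Nonempty := by
    rw [← Finset.card_pos]; omega
  have hx' : α x = x := by simpa using hx
  have gz : ∀ x y z, L x y z → α x = x → β' y = y → γ' z = z := by
    intro x y z hl h1 h2
    have := hp _ _ _ hl
    rw [h1, h2] at this
    exact hL.uz _ _ _ _ this hl
  have gy : ∀ x y z, L x y z → α x = x → γ' z = z → β' y = y := by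
    intro x y z hl h1 h2
    have := hp _ _ _ hl
    rw [h1, h2] at this
    exact hL.uy _ _ _ _ this hl
  have gx : ∀ x y z, L x y z → β' y = y → γ' z = z → α x = x := by
    intro x y z hl h1 h2
    have := hp _ _ _ hl
    rw [h1, h2] at this
    exact hL.ux _ _ _ _ this hl
  set A := Finset.univ.filter fun x : F => α x = x with hAd
  set B := Finset.univ.filter fun x : F => β' x = x with hBd
  set C := Finset.univ.filter fun x : F => γ' x = x with hCd
  have i1 : A.card ≤ C.card := card_le_rel (fun x z => L x y z) (fun x => hL.ez x y)
    (fun _ _ _ h h' => hL.ux _ _ _ _ h h') _ _ (by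
      intro x hx z hl
      simp only [hAd, hCd, Finset.mem_filter, Finset.mem_univ, true_and] at *
      exact gz _ _ _ hl hx hy)
  have i2 : C.card ≤ A.card := card_le_rel (fun z x => L x y z) (fun z => hL.ex y z)
    (fun _ _ _ h h' => hL.uz _ _ _ _ h h') _ _ (by
      intro z hz x hl
      simp only [hAd, hCd, Finset.mem_filter, Finset.mem_univ, true_and] at *
      exact gx _ _ _ hl hy hz)
  have i3 : B.card ≤ C.card := card_le_rel (fun y z => L x y z) (fun y => hL.ez x y)
    (fun _ _ _ h h' => hL.uy _ _ _ _ h h') _ _ (by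
      intro y hy z hl
      simp only [hBd, hCd, Finset.mem_filter, Finset.mem_univ, true_and] at *
      exact gz _ _ _ hl hx' hy)
  have i4 : C.card ≤ B.card := card_le_rel (fun z y => L x y z) (fun z => hL.ey x z)
    (fun _ _ _ h h' => hL.uz _ _ _ _ h h') _ _ (by
      intro z hz y hl
      simp only [hBd, hCd, Finset.mem_filter, Finset.mem_univ, true_and] at *
      exact gy _ _ _ hl hx' hz)
  refine ⟨A, B, C, hA, by omega, by omega, ?_, ?_, ?_⟩ <;> intro x y z hl h1 h2 <;>
    simp only [hAd, hBd, hCd, Finset.mem_filter, Finset.mem_univ, true_and] at h1 h2 ⊢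
  · exact gz _ _ _ hl h1 h2
  · exact gy _ _ _ hl h1 h2
  · exact gx _ _ _ hl h1 h2

/-- Lemma 5.8: if `q > 23` is a prime with `q ≡ 3 (mod 4)` and `(a,b)` is a valid pair
with `a ≠ b`, then no element of `Atp_i(Q_{a,b})` is a product of `(q+1)/4` disjoint
transpositions, i.e. an involution moving exactly `(q+1)/2` points. -/
theorem no_involution_moving_half
    (hprime : Nat.Prime (Fintype.card F)) (hmod : Fintype.card F % 4 = 3)
    (hq : 23 < Fintype.card F)
    (a b : F) (hv : ValidPair a b) (hab : a ≠ b) (i : Fin 3) :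
    ¬ ∃ α ∈ AtpProj a b i, (∀ x : F, α (α x) = x) ∧
        (Finset.univ.filter fun x : F => α x ≠ x).card = (Fintype.card F + 1) / 2 := by
  rintro ⟨δ, ⟨α, β, γ, hatp, hδ⟩, hinv, hmoved⟩
  obtain ⟨k, hk⟩ : ∃ k, Fintype.card F = 4 * k + 3 := ⟨Fintype.card F / 4, by omega⟩
  have hcard : Fintype.card F = 2 * (2 * k + 1) + 1 := by omega
  have hL := QL_lat hv
  have hfix : (Finset.univ.filter fun x : F => δ x = x).card = 2 * k + 1 := by
    have := Finset.card_filter_add_card_filter_not (s := (Finset.univ : Finset F))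
      (fun x : F => δ x = x)
    rw [Finset.card_univ] at this
    have e : (Finset.univ.filter fun x : F => ¬ δ x = x).card = (Fintype.card F + 1) / 2 := hmoved
    omega
  have hat : ∀ x y z, QL a b x y z → QL a b (α x) (β y) (γ z) := by
    rintro x y z rfl
    exact hatp x y
  have hsub : ∃ A B C, Sub3 (QL a b) (2 * k + 1) A B C := by
    fin_cases i
    · obtain rfl : δ = α := hδ
      exact fixed_sub hL (by omega) hcard _ _ _ hat hinv hfix
    · obtain rfl : δ = β := hδ
      obtain ⟨A, B, C, S⟩ := fixed_sub hL.rot (by omega) hcard δ γ α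
        (fun y z x hl => hat x y z hl) hinv hfix
      exact ⟨C, A, B, S.rot.rot⟩
    · obtain rfl : δ = γ := hδ
      obtain ⟨A, B, C, S⟩ := fixed_sub hL.rot.rot (by omega) hcard δ α β
        (fun z x y hl => hat x y z hl) hinv hfix
      exact ⟨B, C, A, S.rot⟩
  obtain ⟨A, B, C, S⟩ := hsub
  obtain ⟨A', B', C', S', hI⟩ := normalize_sub hL (QL_aff a b) (by omega) rfl hk S
  exact final hv hab (by omega) hcard hmod S' hI
end
end
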